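/- Let K be a field of characteristic 2 and V a K-vector space of dimension 2m with symplectic basis x_1,y_1,...,x_m,y_m, and let V_i be the span of {x_i, y_i}. Let H = Sp(V_1) × ... × Sp(V_m) embedded in Sp(V) in the usual manner. Then for every k ≥ 0 there is an isomorphism of H-modules H^k(DV) ≅ ⊕ D_{a_1}V_1 ⊗ ... ⊗ D_{a_m}V_m, where the direct sum ranges over all m-tuples (a_1, ..., a_m) of odd positive integers with a_1 + ... + a_m = k. -/

import Mathlib

noncomputable section

open Finsupp TensorProduct

/-- The underlying space of the divided power algebra `DV` of a vector space `V` with basis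
indexed by `ι`: the free `K`-module on the set of multi-indices, where a multi-index
`a : ι →₀ ℕ` corresponds to the basis monomial `∏ᵢ vᵢ^{(a i)}`. -/
abbrev DPA (K ι : Type) [Field K] := (ι →₀ ℕ) →₀ K

/-- Total degree of a multi-index. -/
def deg {ι : Type} (a : ι →₀ ℕ) : ℕ := a.sum fun _ e => e

/-- The degree-`k` homogeneous component `D_k V` of the divided power algebra. -/
def Dsub (K ι : Type) [Field K] (k : ℕ) : Submodule K (DPA K ι) :=
  Submodule.span K {f | ∃ a : ι →₀ ℕ, deg a = k ∧ f = Finsupp.single a (1 : K)}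

/-- The structure constant of the divided power algebra:
`(∏ᵢ vᵢ^{(a i)}) ⬝ (∏ᵢ vᵢ^{(b i)}) = (∏ᵢ C(a i + b i, a i)) • ∏ᵢ vᵢ^{(a i + b i)}`. -/
def dpCoef {ι : Type} (a b : ι →₀ ℕ) : ℕ :=
  (a + b).prod fun i _ => Nat.choose (a i + b i) (a i)

/-- Multiplication of the divided power algebra, as a bilinear map. -/
def dpMul (K ι : Type) [Field K] : DPA K ι →ₗ[K] DPA K ι →ₗ[K] DPA K ι :=
  Finsupp.lsum K fun a => LinearMap.toSpanSingleton K _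
    (Finsupp.lsum K fun b => LinearMap.toSpanSingleton K _
      ((dpCoef a b : K) • Finsupp.single (a + b) (1 : K)))

/-- Divided power `w^{(n)} ∈ D_n V` of a vector `w = ∑ᵢ wᵢ vᵢ ∈ V`; it is determined by the
rules `(u+v)^{(a)} = ∑ u^{(i)} v^{(a-i)}` and `(t u)^{(a)} = tᵃ u^{(a)}`. -/
def dpow {K ι : Type} [Field K] [Fintype ι] [DecidableEq ι] (w : ι → K) (n : ℕ) : DPA K ι :=
  ∑ c ∈ Finset.univ.finsuppAntidiag n, Finsupp.single c (c.prod fun i e => w i ^ e)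

/-- The image `∏ᵢ (g vᵢ)^{(a i)}` of the basis monomial `∏ᵢ vᵢ^{(a i)}` under the algebra
endomorphism of `DV` induced by the matrix `g`. -/
def actMon {K ι : Type} [Field K] [Fintype ι] [DecidableEq ι]
    (g : Matrix ι ι K) (a : ι →₀ ℕ) : DPA K ι :=
  (a.support.toList.map fun i => dpow (fun j => g j i) (a i)).foldr
    (fun p q => dpMul K ι p q) (Finsupp.single 0 1)

/-- The algebra endomorphism of `DV` induced by the matrix `g` acting on `V` in the given
basis (for `g` invertible this is the induced algebra automorphism of `DV`). -/
def act {K ι : Type} [Field K] [Fintype ι] [DecidableEq ι] (g : Matrix ι ι K) :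
    DPA K ι →ₗ[K] DPA K ι :=
  Finsupp.lsum K fun a => LinearMap.toSpanSingleton K _ (actMon g a)

/-- The entrywise square of a matrix (giving the Frobenius twist of a representation
in characteristic 2). -/
def matSq {K ι : Type} [Field K] (g : Matrix ι ι K) : Matrix ι ι K :=
  fun i j => g i j * g i j

/-! Symplectic setting: `V` has dimension `2m` and symplectic basis `x_1,y_1,…,x_m,y_m`
indexed by `Fin m × Bool`, with `x_i = (i, false)` and `y_i = (i, true)`. -/

/-- The multi-index of the monomial `x_i y_i`. -/
def xyIdx (m : ℕ) (i : Fin m) : (Fin m × Bool) →₀ ℕ :=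
  Finsupp.single (i, false) 1 + Finsupp.single (i, true) 1

/-- The element `ω = x_1 y_1 + ⋯ + x_m y_m ∈ D_2 V`. -/
def omegaDP (K : Type) [Field K] (m : ℕ) : DPA K (Fin m × Bool) :=
  ∑ i : Fin m, Finsupp.single (xyIdx m i) (1 : K)

/-- The differential `∂` of the complex `DV`: multiplication by `ω`.  It restricts to
`∂_k : D_k V → D_{k+2} V`. -/
def del (K : Type) [Field K] (m : ℕ) :
    DPA K (Fin m × Bool) →ₗ[K] DPA K (Fin m × Bool) :=
  dpMul K (Fin m × Bool) (omegaDP K m)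

/-- The matrix of the non-degenerate alternating bilinear form `f` with `f(x_i, y_j) = δᵢⱼ`,
`f(x_i, x_j) = f(y_i, y_j) = 0`. -/
def Jmat (K : Type) [Field K] (m : ℕ) : Matrix (Fin m × Bool) (Fin m × Bool) K :=
  fun p q => if p.1 = q.1 ∧ p.2 ≠ q.2 then 1 else 0

/-- The condition that the matrix `g` belongs to the symplectic group `Sp(V)`:
`g` preserves the form `f`, i.e. `f(gu, gv) = f(u, v)` for all `u, v ∈ V`. -/
def IsSymplectic {K : Type} [Field K] {m : ℕ}
    (g : Matrix (Fin m × Bool) (Fin m × Bool) K) : Prop :=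
  g.transpose * Jmat K m * g = Jmat K m

/-- The cocycles in degree `k`: `ker ∂_k = ker ∂ ∩ D_k V`. -/
def Zmod (K : Type) [Field K] (m k : ℕ) : Submodule K (DPA K (Fin m × Bool)) :=
  LinearMap.ker (del K m) ⊓ Dsub K (Fin m × Bool) k

/-- The coboundaries in degree `k`: `Im ∂_{k-2} = ∂(D_{k-2} V)`.  (For `k = 0, 1`
truncated subtraction gives `∂(D_0 V) ⊆ D_2 V`, which meets `D_k V` only in `0`,
so no harm is done.) -/
def Bful (K : Type) [Field K] (m k : ℕ) : Submodule K (DPA K (Fin m × Bool)) :=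
  Submodule.map (del K m) (Dsub K (Fin m × Bool) (k - 2))

/-- The cohomology `H^k(DV) = ker ∂_k / Im ∂_{k-2}` of the complex `DV`, realized as the
image of `ker ∂_k` in `DV / Im ∂_{k-2}`. -/
abbrev Hcoh (K : Type) [Field K] (m k : ℕ) :=
  ↥(Submodule.map (Bful K m k).mkQ (Zmod K m k))

/-- The canonical projection `ker ∂_k → H^k(DV)`, sending a cocycle `z` to its
cohomology class `z + Im ∂_{k-2}`. -/
def toH (K : Type) [Field K] (m k : ℕ) : ↥(Zmod K m k) →ₗ[K] Hcoh K m k :=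
  LinearMap.codRestrict _ ((Bful K m k).mkQ.comp (Zmod K m k).subtype)
    (fun z => Submodule.mem_map_of_mem z.2)


/-- The span of the monomials `x_1^{(b_1)} y_1^{(c_1)} ⋯ x_m^{(b_m)} y_m^{(c_m)}` of total
degree `k` in which every pair-degree `b_i + c_i` is odd; this is the canonical realization
of `⊕ D_{a_1}V_1 ⊗ ⋯ ⊗ D_{a_m}V_m`, the sum over all `m`-tuples of odd positive integers
with `a_1 + ⋯ + a_m = k`, as an `H = Sp(V_1) × ⋯ × Sp(V_m)`-submodule of `D_k V`. -/
def Modd (K : Type) [Field K] (m k : ℕ) : Submodule K (DPA K (Fin m × Bool)) :=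
  Submodule.span K {f | ∃ a : (Fin m × Bool) →₀ ℕ, deg a = k ∧
    (∀ i : Fin m, Odd (a (i, false) + a (i, true))) ∧ f = Finsupp.single a (1 : K)}

/-- The tuple of pair-degrees of a multi-index. -/
def pd (m : ℕ) : ((Fin m × Bool) →₀ ℕ) →+ (Fin m → ℕ) where
  toFun a := fun i => a (i, false) + a (i, true)
  map_zero' := by ext i; simp
  map_add' a b := by ext i; simp; omega

lemma pd_apply {m : ℕ} (a : (Fin m × Bool) →₀ ℕ) (i : Fin m) :
    pd m a i = a (i, false) + a (i, true) := rfl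

lemma deg_eq_degree {ι : Type} (a : ι →₀ ℕ) : deg a = a.degree := by
  simp [deg, Finsupp.degree_apply, Finsupp.sum]

lemma deg_xy {m : ℕ} (i : Fin m) : deg (xyIdx m i) = 2 := by
  rw [deg_eq_degree, xyIdx, map_add, Finsupp.degree_single, Finsupp.degree_single]

lemma deg_add' {ι : Type} (a b : ι →₀ ℕ) : deg (a + b) = deg a + deg b := by
  simp only [deg_eq_degree, map_add]

lemma dpMul_single {K ι : Type} [Field K] (a b : ι →₀ ℕ) (s t : K) :
    dpMul K ι (single a s) (single b t) = (s * t * (dpCoef a b : K)) • single (a + b) (1 : K) := by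
  simp only [dpMul, Finsupp.lsum_single, LinearMap.toSpanSingleton_apply, LinearMap.smul_apply,
    smul_smul, mul_assoc]

lemma dpCoef_xy {m : ℕ} (i : Fin m) (a : (Fin m × Bool) →₀ ℕ) :
    dpCoef (xyIdx m i) a = (a (i, false) + 1) * (a (i, true) + 1) := by
  classical
  unfold dpCoef
  rw [Finsupp.prod, Finset.prod_subset (Finset.subset_univ _)]
  · rw [Fintype.prod_prod_type, Finset.prod_eq_single i]
    · simp [xyIdx, add_comm, mul_comm]
    · intro j _ hj
      simp [xyIdx, Finsupp.single_apply, hj.symm]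
    · simp
  · intro p _ hp
    have h0 : xyIdx m i p + a p = 0 := by
      rw [← Finsupp.add_apply]; exact Finsupp.notMem_support_iff.mp hp
    have h1 : xyIdx m i p = 0 := by omega
    rw [h0, h1, Nat.choose_zero_right]

lemma del_single {K : Type} [Field K] {m : ℕ} (a : (Fin m × Bool) →₀ ℕ) :
    del K m (single a 1) = ∑ i : Fin m,
      (((a (i, false) + 1) * (a (i, true) + 1) : ℕ) : K) • single (a + xyIdx m i) (1 : K) := by
  simp only [del, omegaDP, map_sum, LinearMap.sum_apply, dpMul_single, dpCoef_xy, one_mul]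
  exact Finset.sum_congr rfl fun i _ => by rw [add_comm a]

open Classical in
/-- The `i`-th contracting homotopy on multi-indices. -/
def hs (K : Type) [Field K] {m : ℕ} (i : Fin m) (a : (Fin m × Bool) →₀ ℕ) :
    DPA K (Fin m × Bool) :=
  if Odd (a (i, false)) ∧ Odd (a (i, true)) then single (a - xyIdx m i) 1 else 0

open Classical in
/-- The contracting homotopy. -/
def hS (K : Type) [Field K] (m : ℕ) :
    DPA K (Fin m × Bool) →ₗ[K] DPA K (Fin m × Bool) :=
  Finsupp.lsum K fun a => LinearMap.toSpanSingleton K _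
    (if h : ∃ i, (fun j => Even (pd m a j)) i then hs K (Classical.choose h) a else 0)

open Classical in
/-- The projection to the all-odd part. -/
def hP (K : Type) [Field K] (m : ℕ) :
    DPA K (Fin m × Bool) →ₗ[K] DPA K (Fin m × Bool) :=
  Finsupp.lsum K fun a => LinearMap.toSpanSingleton K _
    (if ∀ i, Odd (pd m a i) then single a 1 else 0)

open Classical in
lemma hP_single {K : Type} [Field K] {m : ℕ} (a : (Fin m × Bool) →₀ ℕ) :
    hP K m (single a 1) = if ∀ i, Odd (pd m a i) then single a 1 else 0 := by
  simp [hP, LinearMap.toSpanSingleton_apply]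

open Classical in
lemma hS_single {K : Type} [Field K] {m : ℕ} (a : (Fin m × Bool) →₀ ℕ) :
    hS K m (single a 1) =
      if h : ∃ i, (fun j => Even (pd m a j)) i then hs K (Classical.choose h) a else 0 := by
  simp [hS, LinearMap.toSpanSingleton_apply]

lemma pd_xy_even {m : ℕ} (a : (Fin m × Bool) →₀ ℕ) (i j : Fin m) :
    Even (pd m (a + xyIdx m i) j) ↔ Even (pd m a j) := by
  have : Even (pd m (xyIdx m i) j) := by
    by_cases h : i = j
    · subst h; simp [pd_apply, xyIdx]
    · simp [pd_apply, xyIdx, Finsupp.single_apply, h]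
  rw [map_add, Pi.add_apply, Nat.even_add]
  tauto

lemma hS_eq {K : Type} [Field K] {m : ℕ} (a : (Fin m × Bool) →₀ ℕ)
    (h : ∃ i, Even (pd m a i)) : ∃ i, Even (pd m a i) ∧ hS K m (single a 1) = hs K i a ∧
      ∀ j, hS K m (single (a + xyIdx m j) 1) = hs K i (a + xyIdx m j) := by
  classical
  have h' : ∃ i, (fun j => Even (pd m a j)) i := h
  refine ⟨Classical.choose h', Classical.choose_spec h', ?_, ?_⟩
  · rw [hS_single, dif_pos h']
  · intro j
    have e : (fun l => Even (pd m (a + xyIdx m j) l)) = fun l => Even (pd m a l) := by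
      ext l; exact pd_xy_even a j l
    rw [hS_single]
    simp only [e]
    rw [dif_pos h']

lemma cast_coef_zero {K : Type} [Field K] [CharP K 2] {a b : ℕ} (h : ¬ (Even a ∧ Even b)) :
    (((a + 1) * (b + 1) : ℕ) : K) = 0 := by
  rw [CharP.cast_eq_zero_iff K 2]
  rw [← even_iff_two_dvd, Nat.even_mul, Nat.even_add_one, Nat.even_add_one]
  tauto

lemma cast_coef_one {K : Type} [Field K] [CharP K 2] {a b : ℕ} (h : (Even a ∧ Even b)) :
    (((a + 1) * (b + 1) : ℕ) : K) = 1 := by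
  obtain ⟨⟨c, rfl⟩, ⟨d, rfl⟩⟩ := h
  have : (2 : K) = 0 := CharTwo.two_eq_zero
  push_cast
  linear_combination (2 * c * d + c + d : K) * this

lemma xy_false {m : ℕ} (i j : Fin m) : xyIdx m i (j, false) = if i = j then 1 else 0 := by
  simp [xyIdx, Finsupp.single_apply]

lemma xy_true {m : ℕ} (i j : Fin m) : xyIdx m i (j, true) = if i = j then 1 else 0 := by
  simp [xyIdx, Finsupp.single_apply]

lemma xy_le {m : ℕ} (i : Fin m) (a : (Fin m × Bool) →₀ ℕ)
    (h : Odd (a (i, false)) ∧ Odd (a (i, true))) : xyIdx m i ≤ a := by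
  rintro ⟨j, b⟩
  by_cases e : i = j
  · subst e
    cases b
    · rw [xy_false, if_pos rfl]; exact h.1.pos
    · rw [xy_true, if_pos rfl]; exact h.2.pos
  · cases b <;> simp [xy_false, xy_true, e]

lemma homotopy_single {K : Type} [Field K] [CharP K 2] {m : ℕ} (a : (Fin m × Bool) →₀ ℕ)
    (i : Fin m) (hi : Even (pd m a i)) :
    del K m (hs K i a) + ∑ j : Fin m,
      (((a (j, false) + 1) * (a (j, true) + 1) : ℕ) : K) • hs K i (a + xyIdx m j)
      = single a 1 := by
  classical
  rw [pd_apply] at hi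
  by_cases ho : Odd (a (i, false)) ∧ Odd (a (i, true))
  · obtain ⟨b, rfl⟩ : ∃ b, a = b + xyIdx m i := ⟨a - xyIdx m i, (tsub_add_cancel_of_le (xy_le i a ho)).symm⟩
    have hb : Even (b (i, false)) ∧ Even (b (i, true)) := by
      simpa [xy_false, xy_true, Nat.odd_add_one] using ho
    have h1 : hs K i (b + xyIdx m i) = single b 1 := by
      rw [hs, if_pos ho, add_tsub_cancel_right]
    rw [h1, del_single, ← Finset.sum_add_distrib, Finset.sum_eq_single i]
    · rw [cast_coef_one hb, one_smul, cast_coef_zero, zero_smul, add_zero]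
      simp only [Nat.not_even_iff_odd.symm] at ho; tauto
    · intro j _ hj
      have h2 : hs K i (b + xyIdx m i + xyIdx m j) = single (b + xyIdx m j) 1 := by
        rw [hs, if_pos]
        · rw [add_right_comm, add_tsub_cancel_right]
        · simpa [xy_false, xy_true, hj] using ho
      rw [h2]
      simp only [Finsupp.add_apply, xy_false, xy_true, if_neg hj.symm, add_zero]
      rw [← add_smul, CharTwo.add_self_eq_zero, zero_smul]
    · simp
  · have he : Even (a (i, false)) ∧ Even (a (i, true)) := by
      rw [Nat.even_add] at hi
      simp only [← Nat.not_even_iff_odd] at ho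
      tauto
    rw [hs, if_neg ho, map_zero, zero_add, Finset.sum_eq_single i]
    · rw [cast_coef_one he, one_smul, hs, if_pos, add_tsub_cancel_right]
      simpa [xy_false, xy_true, Nat.odd_add_one] using he
    · intro j _ hj
      rw [hs, if_neg, smul_zero]
      simpa [xy_false, xy_true, hj] using ho
    · simp

lemma del_single_odd {K : Type} [Field K] [CharP K 2] {m : ℕ} (a : (Fin m × Bool) →₀ ℕ)
    (h : ∀ i, Odd (pd m a i)) : del K m (single a 1) = 0 := by
  rw [del_single]
  refine Finset.sum_eq_zero fun i _ => ?_
  rw [cast_coef_zero, zero_smul]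
  rintro ⟨h1, h2⟩
  exact (Nat.not_even_iff_odd.mpr (h i)) (h1.add h2)

lemma homotopy {K : Type} [Field K] [CharP K 2] {m : ℕ} (z : DPA K (Fin m × Bool)) :
    del K m (hS K m z) + hS K m (del K m z) + hP K m z = z := by
  classical
  suffices h : (del K m) ∘ₗ (hS K m) + (hS K m) ∘ₗ (del K m) + hP K m = LinearMap.id by
    simpa using LinearMap.congr_fun h z
  refine Finsupp.lhom_ext' fun a => LinearMap.ext_ring ?_
  simp only [LinearMap.comp_apply, LinearMap.add_apply, Finsupp.lsingle_apply, LinearMap.id_apply]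
  by_cases h : ∃ i, Even (pd m a i)
  · obtain ⟨i, hi, h1, h2⟩ := hS_eq (K := K) a h
    rw [hP_single, if_neg, add_zero, h1, del_single, map_sum]
    · simp only [map_smul, h2]
      exact homotopy_single a i hi
    · push Not
      exact ⟨i, Nat.not_odd_iff_even.mpr hi⟩
  · have h' : ∀ i, Odd (pd m a i) := by simpa using h
    rw [del_single_odd a h', hP_single, if_pos h', hS_single, dif_neg h]
    simp

lemma hP_del {K : Type} [Field K] [CharP K 2] {m : ℕ} (z : DPA K (Fin m × Bool)) :
    hP K m (del K m z) = 0 := by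
  classical
  suffices h : (hP K m) ∘ₗ (del K m) = 0 by
    simpa using LinearMap.congr_fun h z
  refine Finsupp.lhom_ext' fun a => LinearMap.ext_ring ?_
  simp only [LinearMap.comp_apply, Finsupp.lsingle_apply, LinearMap.zero_apply]
  by_cases h : ∃ i, Even (pd m a i)
  · rw [del_single, map_sum]
    refine Finset.sum_eq_zero fun j _ => ?_
    obtain ⟨i, hi⟩ := h
    rw [map_smul, hP_single, if_neg, smul_zero]
    intro h
    exact Nat.not_even_iff_odd.mpr (h i) ((pd_xy_even a j i).mpr hi)
  · rw [del_single_odd a (by simpa using h), map_zero]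

lemma hS_mem {K : Type} [Field K] {m k : ℕ} (z : DPA K (Fin m × Bool))
    (hz : z ∈ Dsub K (Fin m × Bool) k) : hS K m z ∈ Dsub K (Fin m × Bool) (k - 2) := by
  classical
  revert z
  change Dsub K (Fin m × Bool) k ≤ (Dsub K (Fin m × Bool) (k - 2)).comap (hS K m)
  refine Submodule.span_le.mpr ?_
  rintro _ ⟨a, rfl, rfl⟩
  change hS K m (single a 1) ∈ Dsub K (Fin m × Bool) (deg a - 2)
  rw [hS_single]
  split_ifs with h
  · rw [hs]
    split_ifs with ho
    · refine Submodule.subset_span ⟨_, ?_, rfl⟩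
      have := congrArg deg (tsub_add_cancel_of_le (xy_le _ a ho))
      rw [deg_add', deg_xy] at this
      omega
    · exact zero_mem _
  · exact zero_mem _

lemma hP_mem {K : Type} [Field K] {m k : ℕ} (z : DPA K (Fin m × Bool))
    (hz : z ∈ Dsub K (Fin m × Bool) k) : hP K m z ∈ Modd K m k := by
  classical
  revert z
  change Dsub K (Fin m × Bool) k ≤ (Modd K m k).comap (hP K m)
  refine Submodule.span_le.mpr ?_
  rintro _ ⟨a, rfl, rfl⟩
  change hP K m (single a 1) ∈ Modd K m (deg a)
  rw [hP_single]
  split_ifs with h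
  · exact Submodule.subset_span ⟨a, rfl, h, rfl⟩
  · exact zero_mem _

lemma Modd_le {K : Type} [Field K] [CharP K 2] {m k : ℕ} : Modd K m k ≤ Zmod K m k := by
  refine Submodule.span_le.mpr ?_
  rintro _ ⟨a, rfl, h, rfl⟩
  exact ⟨del_single_odd a h, Submodule.subset_span ⟨a, rfl, rfl⟩⟩

lemma hP_Modd {K : Type} [Field K] {m k : ℕ} (z : DPA K (Fin m × Bool))
    (hz : z ∈ Modd K m k) : hP K m z = z := by
  classical
  revert z
  change Modd K m k ≤ LinearMap.eqLocus (hP K m) LinearMap.id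
  refine Submodule.span_le.mpr ?_
  rintro _ ⟨a, rfl, h, rfl⟩
  change hP K m (single a 1) = single a 1
  rw [hP_single]
  exact if_pos h

/-- The multi-homogeneous component of pair-degree `d`. -/
def Gd (K : Type) [Field K] {m : ℕ} (d : Fin m → ℕ) : Submodule K (DPA K (Fin m × Bool)) :=
  Submodule.span K {f | ∃ a, pd m a = d ∧ f = single a (1 : K)}

lemma Gd_mul {K : Type} [Field K] {m : ℕ} {d e : Fin m → ℕ} {p q : DPA K (Fin m × Bool)}
    (hp : p ∈ Gd K d) (hq : q ∈ Gd K e) : dpMul K (Fin m × Bool) p q ∈ Gd K (d + e) := by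
  have h1 : ∀ a, pd m a = d → Gd K e ≤ (Gd K (d + e)).comap (dpMul K (Fin m × Bool) (single a 1)) := by
    intro a ha
    refine Submodule.span_le.mpr ?_
    rintro _ ⟨b, hb, rfl⟩
    change dpMul K (Fin m × Bool) (single a 1) (single b 1) ∈ Gd K (d + e)
    rw [dpMul_single]
    exact Submodule.smul_mem _ _ (Submodule.subset_span ⟨a + b, by rw [map_add, ha, hb], rfl⟩)
  have h2 : Gd K d ≤ (Gd K (d + e)).comap ((dpMul K (Fin m × Bool)).flip q) := by
    refine Submodule.span_le.mpr ?_
    rintro _ ⟨a, ha, rfl⟩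
    exact h1 a ha hq
  exact h2 hp

lemma dpow_mem {K : Type} [Field K] {m : ℕ} (g : Matrix (Fin m × Bool) (Fin m × Bool) K)
    (hg : ∀ p q : Fin m × Bool, p.1 ≠ q.1 → g p q = 0) (p : Fin m × Bool) (n : ℕ) :
    dpow (fun j => g j p) n ∈ Gd K (pd m (single p n)) := by
  classical
  refine Submodule.sum_mem _ fun c hc => ?_
  rw [Finset.mem_finsuppAntidiag] at hc
  by_cases h : ∀ q, q.1 ≠ p.1 → c q = 0
  · rw [← mul_one (Finsupp.prod _ _), ← smul_eq_mul, ← Finsupp.smul_single]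
    refine Submodule.smul_mem _ _ (Submodule.subset_span ⟨c, ?_, rfl⟩)
    have hs : ∀ i, i ≠ p.1 → pd m c i = 0 := fun i hi => by
      rw [pd_apply, h (i, false) hi, h (i, true) hi]
    have hsum : ∑ i, pd m c i = n := by
      rw [← hc.1, Fintype.sum_prod_type]
      refine Finset.sum_congr rfl fun i _ => ?_
      rw [pd_apply, Fintype.sum_bool, add_comm]
    rw [Finset.sum_eq_single p.1 (fun i _ hi => hs i hi) (by simp)] at hsum
    ext i
    by_cases hi : i = p.1
    · subst hi
      rw [hsum, pd_apply]
      obtain ⟨i, b⟩ := p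
      cases b <;> simp
    · rw [hs i hi, pd_apply, Finsupp.single_eq_of_ne (a := p) (a' := (i, false)),
        Finsupp.single_eq_of_ne (a := p) (a' := (i, true))]
      · omega
      · rintro rfl; exact hi rfl
      · rintro rfl; exact hi rfl
  · push Not at h
    obtain ⟨q, hq, hcq⟩ := h
    rw [Finsupp.prod, Finset.prod_eq_zero (Finsupp.mem_support_iff.mpr hcq), Finsupp.single_zero]
    · exact zero_mem _
    · simp only [hg q p hq]
      exact zero_pow hcq

lemma actMon_mem {K : Type} [Field K] {m : ℕ} (g : Matrix (Fin m × Bool) (Fin m × Bool) K)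
    (hg : ∀ p q : Fin m × Bool, p.1 ≠ q.1 → g p q = 0) (a : (Fin m × Bool) →₀ ℕ) :
    actMon g a ∈ Gd K (pd m a) := by
  have key : ∀ L : List (Fin m × Bool),
      (L.map fun i => dpow (fun j => g j i) (a i)).foldr
        (fun p q => dpMul K (Fin m × Bool) p q) (Finsupp.single 0 1) ∈
      Gd K (pd m (L.map fun i => single i (a i)).sum) := by
    intro L
    induction L with
    | nil => exact Submodule.subset_span ⟨0, rfl, rfl⟩
    | cons p L ih =>
      simp only [List.map_cons, List.foldr_cons, List.sum_cons, map_add]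
      exact Gd_mul (dpow_mem g hg p _) ih
  have := key a.support.toList
  rw [Finset.sum_map_toList] at this
  rw [← Finsupp.sum, Finsupp.sum_single] at this
  exact this

lemma hP_act {K : Type} [Field K] {m : ℕ} (g : Matrix (Fin m × Bool) (Fin m × Bool) K)
    (hg : ∀ p q : Fin m × Bool, p.1 ≠ q.1 → g p q = 0) (z : DPA K (Fin m × Bool)) :
    hP K m (act g z) = act g (hP K m z) := by
  classical
  suffices h : (hP K m) ∘ₗ (act g) = (act g) ∘ₗ (hP K m) by
    simpa using LinearMap.congr_fun h z
  refine Finsupp.lhom_ext' fun a => LinearMap.ext_ring ?_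
  simp only [LinearMap.comp_apply, Finsupp.lsingle_apply]
  have ha : act g (single a 1) = actMon g a := by
    simp [act, LinearMap.toSpanSingleton_apply]
  have hm := actMon_mem g hg a
  rw [hP_single]
  split_ifs with h
  · rw [ha]
    have : Gd K (pd m a) ≤ LinearMap.eqLocus (hP K m) LinearMap.id := by
      refine Submodule.span_le.mpr ?_
      rintro _ ⟨b, hb, rfl⟩
      change hP K m (single b 1) = single b 1
      rw [hP_single, hb, if_pos h]
    exact this hm
  · rw [ha, map_zero]
    have : Gd K (pd m a) ≤ LinearMap.ker (hP K m) := by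
      refine Submodule.span_le.mpr ?_
      rintro _ ⟨b, hb, rfl⟩
      change hP K m (single b 1) = 0
      rw [hP_single, hb, if_neg h]
    exact this hm

/-- As `H = Sp(V_1) × ⋯ × Sp(V_m)`-modules,
`H^k(DV) ≅ ⊕ D_{a_1}V_1 ⊗ ⋯ ⊗ D_{a_m}V_m`, the sum over all `m`-tuples `(a_1, …, a_m)` of
odd positive integers with `a_1 + ⋯ + a_m = k`: there is a linear map `π` from the cocycles
`ker ∂_k` onto this module whose kernel is exactly the coboundaries `Im ∂_{k-2}` and which
intertwines the action of every block-diagonal symplectic matrix. -/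
theorem statement_3 (K : Type) [Field K] [CharP K 2] (m : ℕ) (hm : 1 ≤ m) (k : ℕ) :
    ∃ π : ↥(Zmod K m k) →ₗ[K] DPA K (Fin m × Bool),
      LinearMap.range π = Modd K m k ∧
      LinearMap.ker π = Submodule.comap (Zmod K m k).subtype (Bful K m k) ∧
      ∀ g : Matrix (Fin m × Bool) (Fin m × Bool) K, IsSymplectic g →
        (∀ p q : Fin m × Bool, p.1 ≠ q.1 → g p q = 0) →
        ∀ z w : ↥(Zmod K m k),
          (w : DPA K (Fin m × Bool)) = act g ↑z → π w = act g (π z) := by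
  refine ⟨(hP K m).comp (Zmod K m k).subtype, ?_, ?_, ?_⟩
  · ext y
    constructor
    · rintro ⟨z, rfl⟩
      exact hP_mem _ z.2.2
    · intro hy
      exact ⟨⟨y, Modd_le hy⟩, hP_Modd y hy⟩
  · ext z
    constructor
    · intro hz
      have hz' : hP K m z = 0 := hz
      have hd : del K m z = 0 := z.2.1
      have h := homotopy (K := K) (z : DPA K (Fin m × Bool))
      rw [hz', hd, map_zero, add_zero, add_zero] at h
      exact ⟨hS K m z, hS_mem _ z.2.2, h⟩
    · rintro ⟨y, -, hy⟩
      change hP K m ((Zmod K m k).subtype z) = 0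
      rw [← hy, hP_del]
  · intro g _ hg z w hw
    change hP K m (w : DPA K (Fin m × Bool)) = act g (hP K m z)
    rw [hw, hP_act g hg]
end
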